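/- Fix a point x ∈ [v_1, v_n] and two weight assignments w and w' with 0 < w_l ≤ w'_l for every index l with v_l < x (weights of vertices at or to the right of x play no role in Φ_L(x)). Then Φ_L(x) computed with w' is greater than or equal to Φ_L(x) computed with w; that is, the total left evacuation time is componentwise nondecreasing in the vertex weights. -/

import Mathlib

open Finset
open scoped Classical

namespace DPN

noncomputable def score (τ c : ℝ) (v w : ℕ → ℝ) (h r j : ℕ) : ℝ :=
  τ * (v h - v j) + (∑ l ∈ Finset.Ioc r j, w l) / c

noncomputable def nextHead (τ c : ℝ) (v w : ℕ → ℝ) (h r : ℕ) : ℕ :=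
  (((Finset.Ioc r h).filter (fun j =>
      ∀ j' ∈ Finset.Ioc r h, score τ c v w h r j' ≤ score τ c v w h r j)).max).getD h

noncomputable def heads (τ c : ℝ) (v w : ℕ → ℝ) (h : ℕ) : ℕ → ℕ
  | 0 => 0
  | m + 1 => nextHead τ c v w h (heads τ c v w h m)

noncomputable def hIdx (n : ℕ) (v : ℕ → ℝ) (x : ℝ) : ℕ :=
  ((Finset.Icc 1 n).filter (fun i => v i < x)).card

noncomputable def phiL (n : ℕ) (τ c : ℝ) (v w : ℕ → ℝ) (x : ℝ) : ℝ :=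
  ∑ m ∈ Finset.range n,
    ((∑ l ∈ Finset.Ioc (heads τ c v w (hIdx n v x) m) (heads τ c v w (hIdx n v x) (m + 1)), w l) *
        (τ * (x - v (heads τ c v w (hIdx n v x) (m + 1)))) +
      (∑ l ∈ Finset.Ioc (heads τ c v w (hIdx n v x) m) (heads τ c v w (hIdx n v x) (m + 1)), w l) ^ 2 /
        (2 * c))

def rv (n : ℕ) (v : ℕ → ℝ) : ℕ → ℝ := fun l => -v (n + 1 - l)

def rw (n : ℕ) (w : ℕ → ℝ) : ℕ → ℝ := fun l => w (n + 1 - l)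

noncomputable def phiR (n : ℕ) (τ c : ℝ) (v w : ℕ → ℝ) (x : ℝ) : ℝ :=
  phiL n τ c (rv n v) (rw n w) (-x)

noncomputable def phi (n : ℕ) (τ c : ℝ) (v w : ℕ → ℝ) (x : ℝ) : ℝ :=
  phiL n τ c v w x + phiR n τ c v w x

/-- The set of scenarios: each vertex weight lies in its interval. -/
def scenarios (n : ℕ) (wm wp : ℕ → ℝ) : Set (ℕ → ℝ) :=
  {s | ∀ i, 1 ≤ i → i ≤ n → wm i ≤ s i ∧ s i ≤ wp i}

/-- The gap `Γ^s(x, y) = Φ^s(x) − Φ^s(y)`. -/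
noncomputable def gap (n : ℕ) (τ c : ℝ) (v s : ℕ → ℝ) (x y : ℝ) : ℝ :=
  phi n τ c v s x - phi n τ c v s y

/-- The regret `R^s(x) = Φ^s(x) − Φ^s(m^s)` (`Φ^s(m^s)` = min of `Φ^s` on `[v_1, v_n]`). -/
noncomputable def regret (n : ℕ) (τ c : ℝ) (v s : ℕ → ℝ) (x : ℝ) : ℝ :=
  phi n τ c v s x - sInf ((fun z => phi n τ c v s z) '' Set.Icc (v 1) (v n))

/-- The maximum regret `R_max(x) = sup_{s ∈ S} R^s(x)`. -/
noncomputable def maxRegret (n : ℕ) (τ c : ℝ) (v wm wp : ℕ → ℝ) (x : ℝ) : ℝ :=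
  sSup {r | ∃ s ∈ scenarios n wm wp, r = regret n τ c v s x}

/-- The left-pseudo-bipartite scenario `s(i, w)`. -/
def pseudoBipL (wm wp : ℕ → ℝ) (i : ℕ) (w : ℝ) : ℕ → ℝ :=
  fun l => if l < i then wp l else if l = i then w else wm l

/-- The right-pseudo-bipartite scenario `s(i, w)`. -/
def pseudoBipR (wm wp : ℕ → ℝ) (i : ℕ) (w : ℝ) : ℕ → ℝ :=
  fun l => if l < i then wm l else if l = i then w else wp l

/-- The head `ρ_m` of the left cluster containing vertex `i`: the smallest cluster head `≥ i`. -/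
noncomputable def clusterHeadOf (τ c : ℝ) (v w : ℕ → ℝ) (h i : ℕ) : ℕ :=
  ((((Finset.range (h + 1)).image (heads τ c v w h)).filter (fun r => i ≤ r)).min).getD h

/-- The head `ρ_{m−1}` preceding the left cluster containing vertex `i`:
the largest cluster head `< i`. -/
noncomputable def prevClusterHeadOf (τ c : ℝ) (v w : ℕ → ℝ) (h i : ℕ) : ℕ :=
  ((((Finset.range (h + 1)).image (heads τ c v w h)).filter (fun r => r < i)).max).getD 0

/-- The weight `σ_m` of the left cluster containing vertex `i`. -/
noncomputable def clusterWeightOf (τ c : ℝ) (v w : ℕ → ℝ) (h i : ℕ) : ℝ :=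
  ∑ l ∈ Finset.Ioc (prevClusterHeadOf τ c v w h i) (clusterHeadOf τ c v w h i), w l

/-- The sequence of right cluster heads for the vertex `y = v_j`
(expressed in the coordinates of the reflected network). -/
noncomputable def rightHeads (n : ℕ) (τ c : ℝ) (v w : ℕ → ℝ) (j : ℕ) : ℕ → ℕ :=
  heads τ c (rv n v) (rw n w) (hIdx n (rv n v) (-(v j)))

/-- The sequence of left cluster heads for the vertex `y = v_j`. -/
noncomputable def leftHeads (n : ℕ) (τ c : ℝ) (v w : ℕ → ℝ) (j : ℕ) : ℕ → ℕ :=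
  heads τ c v w (hIdx n v (v j))

/-- The (original-coordinates) index of the head of the right cluster for `y = v_j`
containing vertex `i`. -/
noncomputable def rightClusterHeadOf (n : ℕ) (τ c : ℝ) (v w : ℕ → ℝ) (j i : ℕ) : ℕ :=
  n + 1 - clusterHeadOf τ c (rv n v) (rw n w) (hIdx n (rv n v) (-(v j))) (n + 1 - i)

/-- The weight of the right cluster for `y = v_j` containing vertex `i`. -/
noncomputable def rightClusterWeightOf (n : ℕ) (τ c : ℝ) (v w : ℕ → ℝ) (j i : ℕ) : ℝ :=
  clusterWeightOf τ c (rv n v) (rw n w) (hIdx n (rv n v) (-(v j))) (n + 1 - i)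

/-- `ω` is a critical weight for `v_i` with respect to the vertex `y = v_j`
(left-pseudo-bipartite case): `ω ∈ {w_i^−, w_i^+}` or the right-cluster partition for `y`
under `s(i, ·)` is not constant on any neighborhood of `ω` in `[w_i^−, w_i^+]`. -/
def criticalWeightL (n : ℕ) (τ c : ℝ) (v wm wp : ℕ → ℝ) (j i : ℕ) (ω : ℝ) : Prop :=
  ω ∈ Set.Icc (wm i) (wp i) ∧
    (ω = wm i ∨ ω = wp i ∨
      ¬ ∃ ε > (0 : ℝ), ∀ w ∈ Set.Icc (wm i) (wp i), |w - ω| < ε →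
        rightHeads n τ c v (pseudoBipL wm wp i w) j =
          rightHeads n τ c v (pseudoBipL wm wp i ω) j)

/-- `ω` is a critical weight for `v_i` with respect to the vertex `y = v_j`
(right-pseudo-bipartite case, using the left-cluster partition for `y`). -/
def criticalWeightR (n : ℕ) (τ c : ℝ) (v wm wp : ℕ → ℝ) (j i : ℕ) (ω : ℝ) : Prop :=
  ω ∈ Set.Icc (wm i) (wp i) ∧
    (ω = wm i ∨ ω = wp i ∨
      ¬ ∃ ε > (0 : ℝ), ∀ w ∈ Set.Icc (wm i) (wp i), |w - ω| < ε →
        leftHeads n τ c v (pseudoBipR wm wp i w) j =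
          leftHeads n τ c v (pseudoBipR wm wp i ω) j)

/-- `Q`: the number of right clusters for `y = v_j` under weights `w` that lie entirely
to the right of the right cluster containing `v_i` (counted via reflected cluster heads). -/
noncomputable def Qnum (n : ℕ) (τ c : ℝ) (v w : ℕ → ℝ) (j i : ℕ) : ℕ :=
  (((Finset.range (n + 1)).image (rightHeads n τ c v w j)).filter
      (fun r => 1 ≤ r ∧
        r < clusterHeadOf τ c (rv n v) (rw n w) (hIdx n (rv n v) (-(v j))) (n + 1 - i))).card

end DPN

open DPN

namespace DPN

/-- The time at which the front of the supply at vertex `i` would reach `x` if it were delayed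
only by the supply located between `i` (exclusive) and `j` (inclusive). -/
noncomputable def frontTime (τ c : ℝ) (v w : ℕ → ℝ) (x : ℝ) (i j : ℕ) : ℝ :=
  τ * (x - v j) + (∑ l ∈ Finset.Ioc i j, w l) / c

/-- The arrival time at `x` of the front of the supply at vertex `i`. -/
noncomputable def frontArrival (τ c : ℝ) (v w : ℕ → ℝ) (x : ℝ) (h i : ℕ) : ℝ :=
  sSup (frontTime τ c v w x i '' Set.Icc i h)

lemma nextHead_spec (τ c : ℝ) (v w : ℕ → ℝ) {h r : ℕ} (hr : r < h) :
    r < nextHead τ c v w h r ∧ nextHead τ c v w h r ≤ h ∧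
      ∀ j, r < j → j ≤ h → score τ c v w h r j ≤ score τ c v w h r (nextHead τ c v w h r) := by
  obtain ⟨k, hk, hmax⟩ := Finset.exists_max_image (Finset.Ioc r h) (score τ c v w h r)
    ⟨h, Finset.mem_Ioc.2 ⟨hr, le_rfl⟩⟩
  obtain ⟨m, hm⟩ := Finset.max_of_mem (s := (Finset.Ioc r h).filter fun j =>
    ∀ j' ∈ Finset.Ioc r h, score τ c v w h r j' ≤ score τ c v w h r j)
    (Finset.mem_filter.2 ⟨hk, hmax⟩)
  have hnext : nextHead τ c v w h r = m := by
    unfold nextHead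
    rw [hm]
    rfl
  have hmem := Finset.mem_filter.1 (Finset.mem_of_max hm)
  rw [hnext]
  exact ⟨(Finset.mem_Ioc.1 hmem.1).1, (Finset.mem_Ioc.1 hmem.1).2,
    fun j h1 h2 => hmem.2 j (Finset.mem_Ioc.2 ⟨h1, h2⟩)⟩

lemma nextHead_self (τ c : ℝ) (v w : ℕ → ℝ) (h : ℕ) : nextHead τ c v w h h = h := by
  simp only [nextHead, Finset.Ioc_self, Finset.filter_empty, Finset.max_empty]
  rfl

lemma heads_le (τ c : ℝ) (v w : ℕ → ℝ) (h m : ℕ) : heads τ c v w h m ≤ h := by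
  induction m with
  | zero => exact Nat.zero_le _
  | succ m ih =>
    rcases ih.lt_or_eq with hlt | heq
    · exact (nextHead_spec τ c v w hlt).2.1
    · rw [heads, heq, nextHead_self]

lemma heads_le_succ (τ c : ℝ) (v w : ℕ → ℝ) (h m : ℕ) :
    heads τ c v w h m ≤ heads τ c v w h (m + 1) := by
  rcases (heads_le τ c v w h m).lt_or_eq with hlt | heq
  · exact (nextHead_spec τ c v w hlt).1.le
  · rw [heads, heq, nextHead_self]

lemma min_le_heads (τ c : ℝ) (v w : ℕ → ℝ) (h m : ℕ) : min m h ≤ heads τ c v w h m := by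
  induction m with
  | zero => simp
  | succ m ih =>
    rcases (heads_le τ c v w h m).lt_or_eq with hlt | heq
    · have := (nextHead_spec τ c v w hlt).1
      rw [heads]
      omega
    · rw [heads, heq, nextHead_self]
      omega

lemma heads_eq_of_le (τ c : ℝ) (v w : ℕ → ℝ) {h m : ℕ} (hm : h ≤ m) :
    heads τ c v w h m = h := by
  have h1 := min_le_heads τ c v w h m
  have h2 := heads_le τ c v w h m
  omega

lemma frontArrival_eq (τ c : ℝ) (v w : ℕ → ℝ) (x : ℝ) {h r i : ℕ} (hri : r < i)
    (hi : i ≤ nextHead τ c v w h r) (hrh : r < h) :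
    frontArrival τ c v w x h i = frontTime τ c v w x i (nextHead τ c v w h r) := by
  obtain ⟨-, h2, h3⟩ := nextHead_spec τ c v w hrh
  refine IsGreatest.csSup_eq ⟨⟨_, ⟨hi, h2⟩, rfl⟩, ?_⟩
  rintro _ ⟨j, ⟨hij, hjh⟩, rfl⟩
  have key := h3 j (hri.trans_le hij) hjh
  unfold score at key
  rw [← Finset.sum_Ioc_consecutive w hri.le hij, ← Finset.sum_Ioc_consecutive w hri.le hi,
    add_div, add_div] at key
  unfold frontTime
  linarith

lemma sum_mul_frontTime (τ c : ℝ) (v w : ℕ → ℝ) (x : ℝ) {r k : ℕ} (hrk : r ≤ k) :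
    ∑ i ∈ Finset.Ioc r k, (w i * frontTime τ c v w x i k + w i ^ 2 / (2 * c)) =
      (∑ l ∈ Finset.Ioc r k, w l) * (τ * (x - v k)) + (∑ l ∈ Finset.Ioc r k, w l) ^ 2 / (2 * c) := by
  induction hrk using Nat.decreasingInduction with
  | self => simp
  | of_succ r hr ih =>
    have split (f : ℕ → ℝ) :
        ∑ i ∈ Finset.Ioc r k, f i = f (r + 1) + ∑ i ∈ Finset.Ioc (r + 1) k, f i := by
      rw [← Finset.sum_Ioc_consecutive f (Nat.le_succ r) hr, Nat.Ioc_succ_singleton,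
        Finset.sum_singleton]
    rw [split, ih, split w, frontTime]
    ring

lemma phiL_eq_sum_frontArrival (n : ℕ) (τ c : ℝ) (v w : ℕ → ℝ) (x : ℝ) (hn : hIdx n v x ≤ n) :
    phiL n τ c v w x = ∑ i ∈ Finset.Ioc 0 (hIdx n v x),
      (w i * frontArrival τ c v w x (hIdx n v x) i + w i ^ 2 / (2 * c)) := by
  set h := hIdx n v x with hh
  have partial_sum (m : ℕ) : ∑ k ∈ Finset.range m,
      ((∑ l ∈ Finset.Ioc (heads τ c v w h k) (heads τ c v w h (k + 1)), w l) *
          (τ * (x - v (heads τ c v w h (k + 1)))) +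
        (∑ l ∈ Finset.Ioc (heads τ c v w h k) (heads τ c v w h (k + 1)), w l) ^ 2 / (2 * c)) =
      ∑ i ∈ Finset.Ioc 0 (heads τ c v w h m),
        (w i * frontArrival τ c v w x h i + w i ^ 2 / (2 * c)) := by
    induction m with
    | zero => simp [heads]
    | succ m ih =>
      rw [Finset.sum_range_succ, ih, ← sum_mul_frontTime τ c v w x (heads_le_succ τ c v w h m),
        ← Finset.sum_Ioc_consecutive _ (Nat.zero_le _) (heads_le_succ τ c v w h m)]
      congr 1
      refine Finset.sum_congr rfl fun i hi => ?_
      obtain ⟨h1, h2⟩ := Finset.mem_Ioc.1 hi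
      rw [frontArrival_eq τ c v w x h1 h2
        (h1.trans_le (h2.trans (heads_le τ c v w h (m + 1)))), heads]
  have := partial_sum n
  rwa [heads_eq_of_le τ c v w hn] at this

lemma hIdx_le (n : ℕ) (v : ℕ → ℝ) (x : ℝ) : hIdx n v x ≤ n := by
  simpa [hIdx] using Finset.card_filter_le (Finset.Icc 1 n) (fun i => v i < x)

lemma lt_of_le_hIdx {n : ℕ} {v : ℕ → ℝ} (hv : ∀ i, 1 ≤ i → i < n → v i < v (i + 1)) {x : ℝ}
    {l : ℕ} (h1 : 1 ≤ l) (hl : l ≤ hIdx n v x) : v l < x := by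
  by_contra! hx
  have mono (k : ℕ) (hk : l ≤ k) : k ≤ n → x ≤ v k := by
    induction k, hk using Nat.le_induction with
    | base => exact fun _ => hx
    | succ k hk ih =>
      exact fun hkn => (ih (by omega)).trans (hv k (by omega) (by omega)).le
  have hsub : (Finset.Icc 1 n).filter (fun i => v i < x) ⊆ Finset.Icc 1 (l - 1) := by
    intro k hk
    obtain ⟨hk1, hk2⟩ := Finset.mem_filter.1 hk
    obtain ⟨hk3, hk4⟩ := Finset.mem_Icc.1 hk1
    have : k < l := by
      by_contra! hlk
      exact (mono k hlk hk4).not_gt hk2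
    exact Finset.mem_Icc.2 ⟨hk3, by omega⟩
  have hcard := Finset.card_le_card hsub
  rw [Nat.card_Icc] at hcard
  unfold hIdx at hl
  omega

lemma frontTime_le_frontArrival (τ c : ℝ) (v w : ℕ → ℝ) (x : ℝ) {h i j : ℕ} (hij : i ≤ j)
    (hjh : j ≤ h) : frontTime τ c v w x i j ≤ frontArrival τ c v w x h i :=
  le_csSup ((Set.finite_Icc i h).image _).bddAbove ⟨j, ⟨hij, hjh⟩, rfl⟩

lemma frontArrival_mono (τ : ℝ) {c : ℝ} (hc : 0 ≤ c) (v : ℕ → ℝ) {w w' : ℕ → ℝ} (x : ℝ)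
    {h i : ℕ} (hi : i ≤ h) (hw : ∀ l, i < l → l ≤ h → w l ≤ w' l) :
    frontArrival τ c v w x h i ≤ frontArrival τ c v w' x h i := by
  refine csSup_le ((Set.nonempty_Icc.2 hi).image _) ?_
  rintro _ ⟨j, ⟨hij, hjh⟩, rfl⟩
  refine le_trans ?_ (frontTime_le_frontArrival τ c v w' x hij hjh)
  have hsum : ∑ l ∈ Finset.Ioc i j, w l ≤ ∑ l ∈ Finset.Ioc i j, w' l :=
    Finset.sum_le_sum fun l hl =>
      hw l (Finset.mem_Ioc.1 hl).1 ((Finset.mem_Ioc.1 hl).2.trans hjh)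
  unfold frontTime
  gcongr

end DPN

theorem stmt6 (n : ℕ) (τ c : ℝ) (hτ : 0 < τ) (hc : 0 < c) (v : ℕ → ℝ)
    (hv : ∀ i, 1 ≤ i → i < n → v i < v (i + 1))
    (w w' : ℕ → ℝ) (x : ℝ) (hx : x ∈ Set.Icc (v 1) (v n))
    (hw : ∀ l, 1 ≤ l → l ≤ n → v l < x → 0 < w l ∧ w l ≤ w' l) :
    phiL n τ c v w x ≤ phiL n τ c v w' x := by
  have hn := hIdx_le n v x
  have hw' (l : ℕ) (h1 : 1 ≤ l) (hl : l ≤ hIdx n v x) : 0 < w l ∧ w l ≤ w' l :=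
    hw l h1 (hl.trans hn) (lt_of_le_hIdx hv h1 hl)
  rw [phiL_eq_sum_frontArrival n τ c v w x hn, phiL_eq_sum_frontArrival n τ c v w' x hn]
  refine Finset.sum_le_sum fun i hi => ?_
  obtain ⟨h1, h2⟩ := Finset.mem_Ioc.1 hi
  obtain ⟨hpos, hle⟩ := hw' i h1 h2
  have hmono := frontArrival_mono τ hc.le v x h2 fun l hl hlh => (hw' l (by omega) hlh).2
  have hnonneg : 0 ≤ frontArrival τ c v w x (hIdx n v x) i := by
    refine le_trans ?_ (frontTime_le_frontArrival τ c v w x le_rfl h2)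
    have := mul_pos hτ (sub_pos.2 (lt_of_le_hIdx hv h1 h2))
    simpa [frontTime] using this.le
  have hpos' := hpos.trans_le hle
  gcongr
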